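/- arXiv:2004.00780 — 4 statements merged into one kernel-verified Lean document; each statement's English description precedes it below -/
import Mathlib

section
/- If q ≠ 1 in k (and q ≠ 0), then the center of Λ_q is exactly the 2-dimensional k-subspace spanned by {1, ab}. -/
noncomputable section

variable (k : Type) [Field k] (q : k)

/-- The generators `e₁, e₂, a, b, c` of the free algebra on five generators. -/
def gL (i : Fin 5) : FreeAlgebra k (Fin 5) := FreeAlgebra.ι k i

/-- The defining relations of the quiver algebra `Λ_q = kQ/I`:
`e₁² = e₁`, `e₂² = e₂`, `e₁e₂ = e₂e₁ = 0`, `e₁ + e₂ = 1`, `e₁ae₁ = a`, `e₁be₁ = b`,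
`e₁ce₂ = c`, `a² = 0`, `b² = 0`, `ab = q·ba`, `ac = 0`
(generators `0 ↦ e₁`, `1 ↦ e₂`, `2 ↦ a`, `3 ↦ b`, `4 ↦ c`). -/
inductive LRel (q : k) : FreeAlgebra k (Fin 5) → FreeAlgebra k (Fin 5) → Prop
  | e1e1 : LRel q (gL k 0 * gL k 0) (gL k 0)
  | e2e2 : LRel q (gL k 1 * gL k 1) (gL k 1)
  | e1e2 : LRel q (gL k 0 * gL k 1) 0
  | e2e1 : LRel q (gL k 1 * gL k 0) 0
  | esum : LRel q (gL k 0 + gL k 1) 1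
  | ea : LRel q (gL k 0 * gL k 2 * gL k 0) (gL k 2)
  | eb : LRel q (gL k 0 * gL k 3 * gL k 0) (gL k 3)
  | ec : LRel q (gL k 0 * gL k 4 * gL k 1) (gL k 4)
  | aa : LRel q (gL k 2 * gL k 2) 0
  | bb : LRel q (gL k 3 * gL k 3) 0
  | ab : LRel q (gL k 2 * gL k 3) (q • (gL k 3 * gL k 2))
  | ac : LRel q (gL k 2 * gL k 4) 0

/-- The quiver algebra `Λ_q = kQ/I` where `Q` has two vertices `1, 2`, loops `a, b`
at vertex `1` and an arrow `c : 1 → 2`, and `I = ⟨a², b², ab − qba, ac⟩`. -/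
def Lam := RingQuot (LRel k q)

instance : Ring (Lam k q) := inferInstanceAs (Ring (RingQuot (LRel k q)))
instance : Algebra k (Lam k q) := inferInstanceAs (Algebra k (RingQuot (LRel k q)))

/-- The image of `e₁` in `Λ_q`. -/
def e1L : Lam k q := (RingQuot.mkAlgHom k (LRel k q) (gL k 0) : RingQuot (LRel k q))
/-- The image of `e₂` in `Λ_q`. -/
def e2L : Lam k q := (RingQuot.mkAlgHom k (LRel k q) (gL k 1) : RingQuot (LRel k q))
/-- The image of `a` in `Λ_q`. -/
def aL : Lam k q := (RingQuot.mkAlgHom k (LRel k q) (gL k 2) : RingQuot (LRel k q))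
/-- The image of `b` in `Λ_q`. -/
def bL : Lam k q := (RingQuot.mkAlgHom k (LRel k q) (gL k 3) : RingQuot (LRel k q))
/-- The image of `c` in `Λ_q`. -/
def cL : Lam k q := (RingQuot.mkAlgHom k (LRel k q) (gL k 4) : RingQuot (LRel k q))


namespace Lam

/-- The quotient map from the free algebra onto `Λ_q`. -/
def mk : FreeAlgebra k (Fin 5) →ₐ[k] Lam k q := RingQuot.mkAlgHom k (LRel k q)

theorem mk_surjective : Function.Surjective (mk k q) :=
  RingQuot.mkAlgHom_surjective k (LRel k q)

variable {k q} in
theorem mk_eq_of_rel {x y : FreeAlgebra k (Fin 5)} (h : LRel k q x y) : mk k q x = mk k q y :=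
  RingQuot.mkAlgHom_rel k h

/-- An algebra homomorphism out of the free algebra respecting the relations factors
through `Λ_q`. -/
theorem exists_lift {B : Type} [Ring B] [Algebra k B] (f : FreeAlgebra k (Fin 5) →ₐ[k] B)
    (hf : ∀ ⦃x y⦄, LRel k q x y → f x = f y) :
    ∃ g : Lam k q →ₐ[k] B, ∀ x, g (mk k q x) = f x :=
  ⟨RingQuot.liftAlgHom k ⟨f, hf⟩, fun x => RingQuot.liftAlgHom_mkAlgHom_apply k f hf x⟩

@[simp] theorem mk_gL_0 : mk k q (gL k 0) = e1L k q := rfl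

@[simp] theorem mk_gL_1 : mk k q (gL k 1) = e2L k q := rfl

@[simp] theorem mk_gL_2 : mk k q (gL k 2) = aL k q := rfl

@[simp] theorem mk_gL_3 : mk k q (gL k 3) = bL k q := rfl

@[simp] theorem mk_gL_4 : mk k q (gL k 4) = cL k q := rfl

theorem e1_mul_e1 : e1L k q * e1L k q = e1L k q := by
  simpa using mk_eq_of_rel (LRel.e1e1 (k := k) (q := q))

theorem e2_mul_e2 : e2L k q * e2L k q = e2L k q := by
  simpa using mk_eq_of_rel (LRel.e2e2 (k := k) (q := q))

theorem e1_mul_e2 : e1L k q * e2L k q = 0 := by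
  simpa using mk_eq_of_rel (LRel.e1e2 (k := k) (q := q))

theorem e2_mul_e1 : e2L k q * e1L k q = 0 := by
  simpa using mk_eq_of_rel (LRel.e2e1 (k := k) (q := q))

theorem e1_add_e2 : e1L k q + e2L k q = 1 := by
  simpa using mk_eq_of_rel (LRel.esum (k := k) (q := q))

theorem e1_mul_a_mul_e1 : e1L k q * aL k q * e1L k q = aL k q := by
  simpa using mk_eq_of_rel (LRel.ea (k := k) (q := q))

theorem e1_mul_b_mul_e1 : e1L k q * bL k q * e1L k q = bL k q := by
  simpa using mk_eq_of_rel (LRel.eb (k := k) (q := q))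

theorem e1_mul_c_mul_e2 : e1L k q * cL k q * e2L k q = cL k q := by
  simpa using mk_eq_of_rel (LRel.ec (k := k) (q := q))

theorem a_mul_a : aL k q * aL k q = 0 := by
  simpa using mk_eq_of_rel (LRel.aa (k := k) (q := q))

theorem b_mul_b : bL k q * bL k q = 0 := by
  simpa using mk_eq_of_rel (LRel.bb (k := k) (q := q))

theorem a_mul_b : aL k q * bL k q = q • (bL k q * aL k q) := by
  simpa using mk_eq_of_rel (LRel.ab (k := k) (q := q))

theorem a_mul_c : aL k q * cL k q = 0 := by
  simpa using mk_eq_of_rel (LRel.ac (k := k) (q := q))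

theorem e1_mul_a : e1L k q * aL k q = aL k q := by
  rw [← e1_mul_a_mul_e1, ← mul_assoc, ← mul_assoc, e1_mul_e1]

theorem a_mul_e1 : aL k q * e1L k q = aL k q := by
  rw [← e1_mul_a_mul_e1, mul_assoc, e1_mul_e1]

theorem e2_mul_a : e2L k q * aL k q = 0 := by
  rw [← e1_mul_a_mul_e1, ← mul_assoc, ← mul_assoc, e2_mul_e1, zero_mul, zero_mul]

theorem a_mul_e2 : aL k q * e2L k q = 0 := by
  rw [← e1_mul_a_mul_e1, mul_assoc, e1_mul_e2, mul_zero]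

theorem e1_mul_b : e1L k q * bL k q = bL k q := by
  rw [← e1_mul_b_mul_e1, ← mul_assoc, ← mul_assoc, e1_mul_e1]

theorem b_mul_e1 : bL k q * e1L k q = bL k q := by
  rw [← e1_mul_b_mul_e1, mul_assoc, e1_mul_e1]

theorem e2_mul_b : e2L k q * bL k q = 0 := by
  rw [← e1_mul_b_mul_e1, ← mul_assoc, ← mul_assoc, e2_mul_e1, zero_mul, zero_mul]

theorem b_mul_e2 : bL k q * e2L k q = 0 := by
  rw [← e1_mul_b_mul_e1, mul_assoc, e1_mul_e2, mul_zero]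

theorem e1_mul_c : e1L k q * cL k q = cL k q := by
  rw [← e1_mul_c_mul_e2, ← mul_assoc, ← mul_assoc, e1_mul_e1]

theorem c_mul_e2 : cL k q * e2L k q = cL k q := by
  rw [← e1_mul_c_mul_e2, mul_assoc, e2_mul_e2]

theorem e2_mul_c : e2L k q * cL k q = 0 := by
  rw [← e1_mul_c_mul_e2, ← mul_assoc, ← mul_assoc, e2_mul_e1, zero_mul, zero_mul]

theorem c_mul_e1 : cL k q * e1L k q = 0 := by
  rw [← e1_mul_c_mul_e2, mul_assoc, e2_mul_e1, mul_zero]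

theorem c_mul_a : cL k q * aL k q = 0 := by
  rw [← e1_mul_a, ← mul_assoc, c_mul_e1, zero_mul]

theorem c_mul_b : cL k q * bL k q = 0 := by
  rw [← e1_mul_b, ← mul_assoc, c_mul_e1, zero_mul]

theorem c_mul_c : cL k q * cL k q = 0 := by
  nth_rw 2 [← e1_mul_c]
  rw [← mul_assoc, c_mul_e1, zero_mul]

/-- The element of `Λ_q` with the given coordinates with respect to the spanning family
`e₁, e₂, a, b, ba, c, bc`. -/
def ofCoords (x y α β γ δ ε : k) : Lam k q :=
  x • e1L k q + y • e2L k q + α • aL k q + β • bL k q + γ • (bL k q * aL k q) + δ • cL k q +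
    ε • (bL k q * cL k q)

variable (x y α β γ δ ε : k)

theorem e1_mul_ofCoords :
    e1L k q * ofCoords k q x y α β γ δ ε = ofCoords k q x 0 α β γ δ ε := by
  simp [ofCoords, mul_add, ← mul_assoc, e1_mul_e1, e1_mul_e2, e1_mul_a, e1_mul_b, e1_mul_c]

theorem e2_mul_ofCoords :
    e2L k q * ofCoords k q x y α β γ δ ε = ofCoords k q 0 y 0 0 0 0 0 := by
  simp [ofCoords, mul_add, ← mul_assoc, e2_mul_e1, e2_mul_e2, e2_mul_a, e2_mul_b, e2_mul_c]

theorem a_mul_ofCoords :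
    aL k q * ofCoords k q x y α β γ δ ε = ofCoords k q 0 0 x 0 (q * β) 0 0 := by
  have h1 : aL k q * (bL k q * aL k q) = 0 := by
    rw [← mul_assoc, a_mul_b, smul_mul_assoc, mul_assoc, a_mul_a, mul_zero, smul_zero]
  have h2 : aL k q * (bL k q * cL k q) = 0 := by
    rw [← mul_assoc, a_mul_b, smul_mul_assoc, mul_assoc, a_mul_c, mul_zero, smul_zero]
  simp [ofCoords, mul_add, h1, h2, a_mul_e1, a_mul_e2, a_mul_a, a_mul_b, a_mul_c, smul_smul,
    mul_comm]

theorem b_mul_ofCoords :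
    bL k q * ofCoords k q x y α β γ δ ε = ofCoords k q 0 0 0 x α 0 δ := by
  simp [ofCoords, mul_add, ← mul_assoc, b_mul_e1, b_mul_e2, b_mul_b]

theorem c_mul_ofCoords :
    cL k q * ofCoords k q x y α β γ δ ε = ofCoords k q 0 0 0 0 0 y 0 := by
  simp [ofCoords, mul_add, ← mul_assoc, c_mul_e1, c_mul_e2, c_mul_a, c_mul_b, c_mul_c]

theorem exists_mk_mul_ofCoords (w : FreeAlgebra k (Fin 5)) :
    ∀ x y α β γ δ ε : k, ∃ x' y' α' β' γ' δ' ε' : k,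
      mk k q w * ofCoords k q x y α β γ δ ε = ofCoords k q x' y' α' β' γ' δ' ε' := by
  induction w using FreeAlgebra.induction with
  | grade0 r =>
    intro x y α β γ δ ε
    refine ⟨r * x, r * y, r * α, r * β, r * γ, r * δ, r * ε, ?_⟩
    rw [AlgHom.commutes, ← Algebra.smul_def]
    simp only [ofCoords, smul_add, smul_smul]
  | grade1 i =>
    intro x y α β γ δ ε
    fin_cases i
    · exact ⟨_, _, _, _, _, _, _, e1_mul_ofCoords k q x y α β γ δ ε⟩
    · exact ⟨_, _, _, _, _, _, _, e2_mul_ofCoords k q x y α β γ δ ε⟩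
    · exact ⟨_, _, _, _, _, _, _, a_mul_ofCoords k q x y α β γ δ ε⟩
    · exact ⟨_, _, _, _, _, _, _, b_mul_ofCoords k q x y α β γ δ ε⟩
    · exact ⟨_, _, _, _, _, _, _, c_mul_ofCoords k q x y α β γ δ ε⟩
  | mul u v hu hv =>
    intro x y α β γ δ ε
    obtain ⟨_, _, _, _, _, _, _, h⟩ := hv x y α β γ δ ε
    rw [map_mul, mul_assoc, h]
    exact hu _ _ _ _ _ _ _
  | add u v hu hv =>
    intro x y α β γ δ ε
    obtain ⟨x₁, y₁, α₁, β₁, γ₁, δ₁, ε₁, h₁⟩ := hu x y α β γ δ ε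
    obtain ⟨x₂, y₂, α₂, β₂, γ₂, δ₂, ε₂, h₂⟩ := hv x y α β γ δ ε
    refine ⟨x₁ + x₂, y₁ + y₂, α₁ + α₂, β₁ + β₂, γ₁ + γ₂, δ₁ + δ₂, ε₁ + ε₂, ?_⟩
    rw [map_add, add_mul, h₁, h₂]
    simp only [ofCoords, add_smul]
    abel

theorem exists_eq_ofCoords (z : Lam k q) :
    ∃ x y α β γ δ ε : k, z = ofCoords k q x y α β γ δ ε := by
  obtain ⟨w, rfl⟩ := mk_surjective k q z
  have h1 : ofCoords k q 1 1 0 0 0 0 0 = 1 := by simp [ofCoords, e1_add_e2]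
  simpa only [h1, mul_one] using exists_mk_mul_ofCoords k q w 1 1 0 0 0 0 0

/-- The representation of `Λ_q` on the projective module `Λ_q e₁`, in the basis
`e₁, a, b, ba`. -/
theorem exists_rep_e1 : ∃ g : Lam k q →ₐ[k] Matrix (Fin 4) (Fin 4) k,
    g (e1L k q) = 1 ∧ g (e2L k q) = 0 ∧
    g (aL k q) = !![0, 0, 0, 0; 1, 0, 0, 0; 0, 0, 0, 0; 0, 0, q, 0] ∧
    g (bL k q) = !![0, 0, 0, 0; 0, 0, 0, 0; 1, 0, 0, 0; 0, 1, 0, 0] ∧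
    g (cL k q) = 0 := by
  obtain ⟨g, hg⟩ := exists_lift k q (FreeAlgebra.lift k
    (![1, 0, !![0, 0, 0, 0; 1, 0, 0, 0; 0, 0, 0, 0; 0, 0, q, 0],
      !![0, 0, 0, 0; 0, 0, 0, 0; 1, 0, 0, 0; 0, 1, 0, 0], 0] :
      Fin 5 → Matrix (Fin 4) (Fin 4) k)) (by
    intro x y h
    cases h <;> simp [gL, ← Matrix.ext_iff, funext_iff, Fin.forall_fin_succ])
  refine ⟨g, (hg (gL k 0)).trans ?_, (hg (gL k 1)).trans ?_, (hg (gL k 2)).trans ?_,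
    (hg (gL k 3)).trans ?_, (hg (gL k 4)).trans ?_⟩ <;> simp [gL]

/-- The representation of `Λ_q` on the projective module `Λ_q e₂`, in the basis
`e₂, c, bc`. -/
theorem exists_rep_e2 : ∃ g : Lam k q →ₐ[k] Matrix (Fin 3) (Fin 3) k,
    g (e1L k q) = !![0, 0, 0; 0, 1, 0; 0, 0, 1] ∧
    g (e2L k q) = !![1, 0, 0; 0, 0, 0; 0, 0, 0] ∧
    g (aL k q) = 0 ∧
    g (bL k q) = !![0, 0, 0; 0, 0, 0; 0, 1, 0] ∧
    g (cL k q) = !![0, 0, 0; 1, 0, 0; 0, 0, 0] := by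
  obtain ⟨g, hg⟩ := exists_lift k q (FreeAlgebra.lift k
    (![!![0, 0, 0; 0, 1, 0; 0, 0, 1], !![1, 0, 0; 0, 0, 0; 0, 0, 0], 0,
      !![0, 0, 0; 0, 0, 0; 0, 1, 0], !![0, 0, 0; 1, 0, 0; 0, 0, 0]] :
      Fin 5 → Matrix (Fin 3) (Fin 3) k)) (by
    intro x y h
    cases h <;> simp [gL, ← Matrix.ext_iff, funext_iff, Fin.forall_fin_succ])
  refine ⟨g, (hg (gL k 0)).trans ?_, (hg (gL k 1)).trans ?_, (hg (gL k 2)).trans ?_,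
    (hg (gL k 3)).trans ?_, (hg (gL k 4)).trans ?_⟩ <;> simp [gL]

variable {k q}

theorem ofCoords_eq_of_mem_center (hq1 : q ≠ 1) {x y α β γ δ ε : k}
    (hz : ofCoords k q x y α β γ δ ε ∈ Subalgebra.center k (Lam k q)) :
    x = y ∧ α = 0 ∧ β = 0 ∧ δ = 0 ∧ ε = 0 := by
  rw [Subalgebra.mem_center_iff] at hz
  obtain ⟨g, g1, g2, ga, gb, gc⟩ := exists_rep_e1 k q
  obtain ⟨f, f1, f2, fa, fb, fc⟩ := exists_rep_e2 k q
  have hb := congrArg (fun w => g w 3 0) (hz (bL k q))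
  have hc := congrArg f (hz (cL k q))
  have he := congrArg f (hz (e1L k q))
  have hc1 := congrFun (congrFun hc 1) 0
  have hc2 := congrFun (congrFun hc 2) 0
  have he1 := congrFun (congrFun he 1) 0
  have he2 := congrFun (congrFun he 2) 0
  simp [ofCoords, g1, g2, ga, gb, gc, Matrix.mul_apply, Fin.sum_univ_succ] at hb
  simp [ofCoords, f1, f2, fa, fb, fc, Matrix.mul_apply, Fin.sum_univ_succ] at hc1 hc2 he1 he2
  refine ⟨hc1.symm, ?_, hc2.symm, he1, he2⟩
  by_contra hα
  exact hq1 (mul_left_cancel₀ hα (by rw [mul_one, ← hb]))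

theorem linearIndependent_one_ab (hq0 : q ≠ 0) :
    LinearIndependent k ![1, aL k q * bL k q] := by
  rw [LinearIndependent.pair_iff]
  intro s t h
  obtain ⟨g, g1, g2, ga, gb, gc⟩ := exists_rep_e1 k q
  have h0 := congrArg (fun w => g w 0 0) h
  have h3 := congrArg (fun w => g w 3 0) h
  simp [ga, gb] at h0 h3
  exact ⟨h0, h3.resolve_right hq0⟩

theorem b_mul_a_mem_center : bL k q * aL k q ∈ Subalgebra.center k (Lam k q) := by
  rw [Subalgebra.mem_center_iff]
  intro z
  obtain ⟨x, y, α, β, γ, δ, ε, rfl⟩ := exists_eq_ofCoords k q z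
  have h : aL k q * (bL k q * aL k q) = 0 := by
    rw [← mul_assoc, a_mul_b, smul_mul_assoc, mul_assoc, a_mul_a, mul_zero, smul_zero]
  rw [mul_assoc (bL k q), a_mul_ofCoords, b_mul_ofCoords]
  simp only [ofCoords, add_mul, smul_mul_assoc, mul_assoc, h]
  simp [← mul_assoc, e1_mul_b, e2_mul_b, b_mul_b, c_mul_b]

theorem mem_center_iff (hq0 : q ≠ 0) (hq1 : q ≠ 1) (z : Lam k q) :
    z ∈ Subalgebra.center k (Lam k q) ↔
      z ∈ Submodule.span k ({1, aL k q * bL k q} : Set (Lam k q)) := by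
  rw [Submodule.mem_span_pair]
  constructor
  · intro hz
    obtain ⟨x, y, α, β, γ, δ, ε, rfl⟩ := exists_eq_ofCoords k q z
    obtain ⟨rfl, rfl, rfl, rfl, rfl⟩ := ofCoords_eq_of_mem_center hq1 hz
    refine ⟨x, γ * q⁻¹, ?_⟩
    rw [a_mul_b, smul_smul, inv_mul_cancel_right₀ hq0, ← e1_add_e2]
    simp [ofCoords]
  · rintro ⟨s, t, rfl⟩
    rw [a_mul_b]
    exact add_mem (Subalgebra.smul_mem _ (one_mem _) _)
      (Subalgebra.smul_mem _ (Subalgebra.smul_mem _ b_mul_a_mem_center _) _)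

end Lam

set_option synthInstance.maxHeartbeats 1000000 in
/-- STATEMENT 3: if `q ≠ 1` (and `q ≠ 0`) then the center of `Λ_q` is exactly the
2-dimensional `k`-subspace spanned by `{1, ab}`. -/
theorem stmt3 (hq0 : q ≠ 0) (hq1 : q ≠ 1) :
    (∀ z : Lam k q, z ∈ Subalgebra.center k (Lam k q) ↔
      z ∈ Submodule.span k ({1, aL k q * bL k q} : Set (Lam k q))) ∧
    Module.finrank k (Subalgebra.center k (Lam k q)) = 2 := by
  refine ⟨Lam.mem_center_iff hq0 hq1, ?_⟩
  have h : Subalgebra.toSubmodule (Subalgebra.center k (Lam k q)) =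
      Submodule.span k (Set.range ![1, aL k q * bL k q]) := by
    ext z
    rw [Matrix.range_cons_cons_empty]
    exact Lam.mem_center_iff hq0 hq1 z
  rw [← Subalgebra.finrank_toSubmodule, h,
    finrank_span_eq_card (Lam.linearIndependent_one_ab hq0), Fintype.card_fin]

end
end

section
/- For every nonzero q ∈ k, the algebra Λ_q is 7-dimensional over k, and the images of e₁, e₂, a, b, ab, c, bc form a k-basis of Λ_q. -/
noncomputable section

variable (k : Type) [Field k] (q : k)

/-- Left multiplication by the generators of `Λ_q` in coordinates with respect to
`e₁, e₂, a, b, ab, c, bc`. -/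
def genMatrix : Fin 5 → Matrix (Fin 7) (Fin 7) k :=
  ![∑ i ∈ {0, 2, 3, 4, 5, 6}, Matrix.single i i 1,
    Matrix.single 1 1 1,
    Matrix.single 2 0 1 + Matrix.single 4 3 1,
    Matrix.single 3 0 1 + Matrix.single 4 2 q⁻¹ + Matrix.single 6 5 1,
    Matrix.single 5 1 1]

theorem lift_genMatrix_eq_of_lRel (hq : q ≠ 0) ⦃x y : FreeAlgebra k (Fin 5)⦄
    (h : LRel k q x y) :
    FreeAlgebra.lift k (genMatrix k q) x = FreeAlgebra.lift k (genMatrix k q) y := by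
  cases h
  case esum =>
    ext i j
    fin_cases i <;> fin_cases j <;> simp [gL, genMatrix]
  all_goals
    simp [gL, genMatrix, mul_add, add_mul, hq, add_assoc]

/-- The representation of `Λ_q` by left multiplication on itself, in coordinates. -/
def matrixRep (hq : q ≠ 0) : Lam k q →ₐ[k] Matrix (Fin 7) (Fin 7) k :=
  (RingQuot.liftAlgHom k
    ⟨FreeAlgebra.lift k (genMatrix k q), lift_genMatrix_eq_of_lRel k q hq⟩ :
      RingQuot (LRel k q) →ₐ[k] Matrix (Fin 7) (Fin 7) k)

/-- The quotient map from the free algebra onto `Λ_q`. -/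
def toLam : FreeAlgebra k (Fin 5) →ₐ[k] Lam k q :=
  (RingQuot.mkAlgHom k (LRel k q) : FreeAlgebra k (Fin 5) →ₐ[k] RingQuot (LRel k q))

theorem toLam_gL_zero : toLam k q (gL k 0) = e1L k q := rfl

theorem toLam_gL_one : toLam k q (gL k 1) = e2L k q := rfl

theorem toLam_gL_two : toLam k q (gL k 2) = aL k q := rfl

theorem toLam_gL_three : toLam k q (gL k 3) = bL k q := rfl

theorem toLam_gL_four : toLam k q (gL k 4) = cL k q := rfl

theorem toLam_surjective : Function.Surjective (toLam k q) :=
  RingQuot.mkAlgHom_surjective k (LRel k q)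

theorem toLam_eq_of_lRel {x y : FreeAlgebra k (Fin 5)} (h : LRel k q x y) :
    toLam k q x = toLam k q y :=
  RingQuot.mkAlgHom_rel k h

theorem matrixRep_toLam (hq : q ≠ 0) (x : FreeAlgebra k (Fin 5)) :
    matrixRep k q hq (toLam k q x) = FreeAlgebra.lift k (genMatrix k q) x :=
  RingQuot.liftAlgHom_mkAlgHom_apply k _ (lift_genMatrix_eq_of_lRel k q hq) x

theorem matrixRep_gL (hq : q ≠ 0) (i : Fin 5) :
    matrixRep k q hq (toLam k q (gL k i)) = genMatrix k q i := by
  rw [matrixRep_toLam, gL, FreeAlgebra.lift_ι_apply]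

/-- The family `e₁, e₂, a, b, ab, c, bc` in `Λ_q`. -/
abbrev pathFamily : Fin 7 → Lam k q :=
  ![e1L k q, e2L k q, aL k q, bL k q, aL k q * bL k q, cL k q, bL k q * cL k q]

theorem linearIndependent_pathFamily (hq : q ≠ 0) : LinearIndependent k (pathFamily k q) := by
  let φ : Lam k q →ₗ[k] (Fin 7 → k) :=
    (LinearMap.applyₗ (![1, 1, 0, 0, 0, 0, 0] : Fin 7 → k)).comp
      ((Matrix.toLin' (R := k) (m := Fin 7) (n := Fin 7)).toLinearMap.comp
        (matrixRep k q hq).toLinearMap)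
  have hφ (x : Lam k q) : φ x = (matrixRep k q hq x).mulVec ![1, 1, 0, 0, 0, 0, 0] := rfl
  have h0 : matrixRep k q hq (e1L k q) = _ := matrixRep_gL k q hq 0
  have h1 : matrixRep k q hq (e2L k q) = _ := matrixRep_gL k q hq 1
  have h2 : matrixRep k q hq (aL k q) = _ := matrixRep_gL k q hq 2
  have h3 : matrixRep k q hq (bL k q) = _ := matrixRep_gL k q hq 3
  have h4 : matrixRep k q hq (cL k q) = _ := matrixRep_gL k q hq 4
  apply LinearIndependent.of_comp φ
  convert (Pi.basisFun k (Fin 7)).linearIndependent using 1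
  funext i
  rw [Function.comp_apply, hφ, Pi.basisFun_apply]
  have hs (i j : Fin 7) (r : k) (v : Fin 7 → k) :
      (Matrix.single i j r).mulVec v = Pi.single i (r * v j) := Matrix.single_mulVec i j r v
  fin_cases i <;>
    simp [pathFamily, h0, h1, h2, h3, h4, genMatrix, mul_add, add_mul, Matrix.add_mulVec, hs]

theorem generator_mul_mem_span (hq : q ≠ 0) (i : Fin 5) (j : Fin 7) :
    toLam k q (gL k i) * pathFamily k q j ∈ Submodule.span k (Set.range (pathFamily k q)) := by
  have hm (j : Fin 7) : pathFamily k q j ∈ Submodule.span k (Set.range (pathFamily k q)) :=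
    Submodule.subset_span ⟨j, rfl⟩
  have e1e1 : e1L k q * e1L k q = e1L k q := by
    simpa only [map_mul, toLam_gL_zero] using
      toLam_eq_of_lRel k q .e1e1
  have e2e2 : e2L k q * e2L k q = e2L k q := by
    simpa only [map_mul, toLam_gL_one] using
      toLam_eq_of_lRel k q .e2e2
  have e1e2 : e1L k q * e2L k q = 0 := by
    simpa only [map_mul, map_zero, toLam_gL_zero, toLam_gL_one] using
      toLam_eq_of_lRel k q .e1e2
  have e2e1 : e2L k q * e1L k q = 0 := by
    simpa only [map_mul, map_zero, toLam_gL_zero, toLam_gL_one] using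
      toLam_eq_of_lRel k q .e2e1
  have ea : e1L k q * aL k q * e1L k q = aL k q := by
    simpa only [map_mul, toLam_gL_zero, toLam_gL_two] using
      toLam_eq_of_lRel k q .ea
  have eb : e1L k q * bL k q * e1L k q = bL k q := by
    simpa only [map_mul, toLam_gL_zero, toLam_gL_three] using
      toLam_eq_of_lRel k q .eb
  have ec : e1L k q * cL k q * e2L k q = cL k q := by
    simpa only [map_mul, toLam_gL_zero, toLam_gL_one, toLam_gL_four] using
      toLam_eq_of_lRel k q .ec
  have aa : aL k q * aL k q = 0 := by
    simpa only [map_mul, map_zero, toLam_gL_two] using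
      toLam_eq_of_lRel k q .aa
  have bb : bL k q * bL k q = 0 := by
    simpa only [map_mul, map_zero, toLam_gL_three] using
      toLam_eq_of_lRel k q .bb
  have ab : aL k q * bL k q = q • (bL k q * aL k q) := by
    simpa only [map_mul, map_smul, toLam_gL_two, toLam_gL_three] using
      toLam_eq_of_lRel k q .ab
  have ac : aL k q * cL k q = 0 := by
    simpa only [map_mul, map_zero, toLam_gL_two, toLam_gL_four] using
      toLam_eq_of_lRel k q .ac
  have m0 : e1L k q ∈ _ := hm 0
  have m1 : e2L k q ∈ _ := hm 1
  have m2 : aL k q ∈ _ := hm 2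
  have m3 : bL k q ∈ _ := hm 3
  have m4 : aL k q * bL k q ∈ _ := hm 4
  have m5 : cL k q ∈ _ := hm 5
  have m6 : bL k q * cL k q ∈ _ := hm 6
  generalize Submodule.span k (Set.range (pathFamily k q)) = S at *
  have hg : toLam k q (gL k i) = ![e1L k q, e2L k q, aL k q, bL k q, cL k q] i := by
    fin_cases i <;> rfl
  rw [hg]
  clear hm hg
  simp only [pathFamily]
  generalize e1L k q = e at *
  generalize e2L k q = f at *
  generalize aL k q = a at *
  generalize bL k q = b at *
  generalize cL k q = c at *
  have e1a : e * a = a := by rw [← ea]; simp only [← mul_assoc, e1e1]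
  have e1b : e * b = b := by rw [← eb]; simp only [← mul_assoc, e1e1]
  have e1c : e * c = c := by rw [← ec]; simp only [← mul_assoc, e1e1]
  have ae1 : a * e = a := by rw [← ea]; simp only [mul_assoc, e1e1]
  have be1 : b * e = b := by rw [← eb]; simp only [mul_assoc, e1e1]
  have ce2 : c * f = c := by rw [← ec]; simp only [mul_assoc, e2e2]
  have e2a : f * a = 0 := by rw [← e1a, ← mul_assoc, e2e1, zero_mul]
  have e2b : f * b = 0 := by rw [← e1b, ← mul_assoc, e2e1, zero_mul]
  have e2c : f * c = 0 := by rw [← e1c, ← mul_assoc, e2e1, zero_mul]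
  have ae2 : a * f = 0 := by rw [← ae1, mul_assoc, e1e2, mul_zero]
  have be2 : b * f = 0 := by rw [← be1, mul_assoc, e1e2, mul_zero]
  have ce1 : c * e = 0 := by rw [← ce2, mul_assoc, e2e1, mul_zero]
  have ca : c * a = 0 := by rw [← ce2, mul_assoc, e2a, mul_zero]
  have cb : c * b = 0 := by rw [← ce2, mul_assoc, e2b, mul_zero]
  have cc : c * c = 0 := by nth_rw 1 [← ce2]; rw [mul_assoc, e2c, mul_zero]
  have ba : b * a = q⁻¹ • (a * b) := by rw [ab, inv_smul_smul₀ hq]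
  have abc : a * (b * c) = 0 := by
    rw [← mul_assoc, ab, smul_mul_assoc, mul_assoc, ac, mul_zero, smul_zero]
  have bab : b * (a * b) = 0 := by
    rw [ab, mul_smul_comm, ← mul_assoc, bb, zero_mul, smul_zero]
  have mba : b * a ∈ S := ba ▸ S.smul_mem _ m4
  clear ab ba
  have eab : e * (a * b) = a * b := by rw [← mul_assoc, e1a]
  have ebc : e * (b * c) = b * c := by rw [← mul_assoc, e1b]
  have fab : f * (a * b) = 0 := by rw [← mul_assoc, e2a, zero_mul]
  have fbc : f * (b * c) = 0 := by rw [← mul_assoc, e2b, zero_mul]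
  have aab : a * (a * b) = 0 := by rw [← mul_assoc, aa, zero_mul]
  have bbc : b * (b * c) = 0 := by rw [← mul_assoc, bb, zero_mul]
  have cab : c * (a * b) = 0 := by rw [← mul_assoc, ca, zero_mul]
  have cbc : c * (b * c) = 0 := by rw [← mul_assoc, cb, zero_mul]
  fin_cases i <;> fin_cases j <;> simp [*]

theorem one_mem_span : (1 : Lam k q) ∈ Submodule.span k (Set.range (pathFamily k q)) := by
  have h : e1L k q + e2L k q = 1 := by
    simpa only [map_add, map_one, toLam_gL_zero, toLam_gL_one] using
      toLam_eq_of_lRel k q .esum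
  rw [← h]
  exact add_mem (Submodule.subset_span ⟨0, rfl⟩) (Submodule.subset_span ⟨1, rfl⟩)

theorem span_pathFamily (hq : q ≠ 0) :
    Submodule.span k (Set.range (pathFamily k q)) = ⊤ := by
  have key (x : FreeAlgebra k (Fin 5)) :
      ∀ y ∈ Submodule.span k (Set.range (pathFamily k q)),
        toLam k q x * y ∈ Submodule.span k (Set.range (pathFamily k q)) := by
    induction x using FreeAlgebra.induction with
    | grade0 r =>
      intro y hy
      rw [AlgHom.commutes, ← Algebra.smul_def]
      exact Submodule.smul_mem _ _ hy
    | grade1 i =>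
      intro y hy
      induction hy using Submodule.span_induction with
      | mem y hy =>
        obtain ⟨j, rfl⟩ := hy
        exact generator_mul_mem_span k q hq i j
      | zero => simp
      | add y z _ _ hy hz => rw [mul_add]; exact add_mem hy hz
      | smul r y _ hy => rw [mul_smul_comm]; exact Submodule.smul_mem _ _ hy
    | mul x z hx hz =>
      intro y hy
      rw [map_mul, mul_assoc]
      exact hx _ (hz y hy)
    | add x z hx hz =>
      intro y hy
      rw [map_add, add_mul]
      exact add_mem (hx y hy) (hz y hy)
  refine eq_top_iff.2 fun y _ => ?_
  obtain ⟨x, rfl⟩ := toLam_surjective k q y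
  simpa using key x 1 (one_mem_span k q)

/-- STATEMENT 5: for every nonzero `q`, the algebra `Λ_q` is 7-dimensional over `k`
and the images of `e₁, e₂, a, b, ab, c, bc` form a `k`-basis of `Λ_q`. -/
theorem stmt5 (hq : q ≠ 0) :
    Module.finrank k (Lam k q) = 7 ∧
    LinearIndependent k
      ![e1L k q, e2L k q, aL k q, bL k q, aL k q * bL k q, cL k q, bL k q * cL k q] ∧
    Submodule.span k
      (Set.range
        ![e1L k q, e2L k q, aL k q, bL k q, aL k q * bL k q, cL k q, bL k q * cL k q]) = ⊤ := by
  refine ⟨?_, linearIndependent_pathFamily k q hq, span_pathFamily k q hq⟩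
  rw [Module.finrank_eq_card_basis
    (Module.Basis.mk (linearIndependent_pathFamily k q hq) (span_pathFamily k q hq).ge),
    Fintype.card_fin]

end
end

section
/- In the free associative algebra k⟨a,b⟩, define elements f^n_i for integers n ≥ 0 and 0 ≤ i ≤ n by f⁰₀ = 1, f^n_0 = aⁿ, f^n_n = bⁿ, and f^n_i = f^{n−1}_{i−1}·b + (−q)^i f^{n−1}_i·a for 0 < i < n. Then for all integers 0 ≤ t ≤ n and 0 ≤ r ≤ n, one has f^n_r = Σ_{j = max(0, r+t−n)}^{min(t, r)} (−q)^{j(n−r+j−t)} f^t_j · f^{n−t}_{r−j}. -/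
noncomputable section

variable (k : Type) [Field k] (q : k)

/-- The generator `a` of the free algebra `k⟨a,b⟩`. -/
def Xa : FreeAlgebra k (Fin 2) := FreeAlgebra.ι k 0
/-- The generator `b` of the free algebra `k⟨a,b⟩`. -/
def Xb : FreeAlgebra k (Fin 2) := FreeAlgebra.ι k 1

/-- The elements `f^n_i` of the free algebra `k⟨a,b⟩`:
`f⁰₀ = 1`, `f^n_0 = aⁿ`, `f^n_n = bⁿ`, and
`f^n_i = f^{n−1}_{i−1}·b + (−q)^i f^{n−1}_i·a` for `0 < i < n`. -/
def fgen : ℕ → ℕ → FreeAlgebra k (Fin 2)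
  | 0, 0 => 1
  | 0, _ + 1 => 0
  | n + 1, i =>
    if i = 0 then Xa k ^ (n + 1)
    else if i = n + 1 then Xb k ^ (n + 1)
    else if i ≤ n then fgen n (i - 1) * Xb k + ((-q) ^ i) • (fgen n i * Xa k)
    else 0

theorem fgen_zero_right (n : ℕ) : fgen k q n 0 = Xa k ^ n := by
  cases n <;> simp [fgen]

theorem fgen_eq_zero_of_lt {n i : ℕ} (h : n < i) : fgen k q n i = 0 := by
  cases n with
  | zero => obtain ⟨i, rfl⟩ := Nat.exists_eq_succ_of_ne_zero h.ne'; simp [fgen]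
  | succ n =>
    rw [fgen, if_neg (by omega), if_neg (by omega), if_neg (by omega)]

theorem fgen_self (n : ℕ) : fgen k q n n = Xb k ^ n := by
  cases n <;> simp [fgen]

/-- The defining recursion holds for every index, including the boundary ones. -/
theorem fgen_succ_succ (n i : ℕ) :
    fgen k q (n + 1) (i + 1) =
      fgen k q n i * Xb k + ((-q) ^ (i + 1)) • (fgen k q n (i + 1) * Xa k) := by
  rcases lt_trichotomy i n with h | rfl | h
  · rw [fgen, if_neg (by omega), if_neg (by omega), if_pos (by omega), Nat.add_sub_cancel]
  · rw [fgen_self, fgen_self, fgen_eq_zero_of_lt k q (Nat.lt_succ_self i), pow_succ]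
    simp
  · rw [fgen_eq_zero_of_lt k q (by omega), fgen_eq_zero_of_lt k q h,
      fgen_eq_zero_of_lt k q (by omega)]
    simp

theorem fgen_add (t m r : ℕ) :
    fgen k q (t + m) r =
      ∑ p ∈ Finset.HasAntidiagonal.antidiagonal r,
        ((-q) ^ (p.1 * (m - p.2))) • (fgen k q t p.1 * fgen k q m p.2) := by
  induction m generalizing r with
  | zero =>
    rw [Finset.sum_eq_single (r, 0)]
    · simp [fgen]
    · rintro ⟨j, l⟩ hp hne
      have hl : 0 < l := by
        rw [Finset.HasAntidiagonal.mem_antidiagonal] at hp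
        by_contra hl
        exact hne (by ext <;> simp at hp ⊢ <;> omega)
      simp [fgen_eq_zero_of_lt k q hl]
    · simp
  | succ m ih =>
    cases r with
    | zero => simp [fgen_zero_right, pow_add]
    | succ r =>
      rw [← add_assoc, fgen_succ_succ, ih r, ih (r + 1), Finset.Nat.sum_antidiagonal_succ',
        Finset.Nat.sum_antidiagonal_succ']
      have hterm : ∀ p ∈ Finset.HasAntidiagonal.antidiagonal r,
          ((-q) ^ (p.1 * (m + 1 - (p.2 + 1)))) •
              (fgen k q t p.1 * fgen k q (m + 1) (p.2 + 1)) =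
            ((-q) ^ (p.1 * (m - p.2))) • (fgen k q t p.1 * fgen k q m p.2) * Xb k +
            ((-q) ^ (r + 1)) • (((-q) ^ (p.1 * (m - (p.2 + 1)))) •
              (fgen k q t p.1 * fgen k q m (p.2 + 1)) * Xa k) := by
        rintro ⟨j, l⟩ hp
        obtain rfl : j + l = r := by simpa using hp
        simp only [fgen_succ_succ, Nat.add_sub_add_right, mul_add, smul_add, mul_smul_comm,
          smul_mul_assoc, smul_smul, mul_assoc, ← pow_add]
        congr 1
        rcases lt_or_ge l m with h | h
        · obtain ⟨d, rfl⟩ := Nat.exists_eq_add_of_lt h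
          rw [show l + d + 1 - l = d + 1 by omega, show l + d + 1 - (l + 1) = d by omega]
          congr 2
          ring
        · simp [fgen_eq_zero_of_lt k q (show m < l + 1 by omega)]
      rw [Finset.sum_congr rfl hterm, Finset.sum_add_distrib, ← Finset.sum_mul,
        ← Finset.smul_sum, ← Finset.sum_mul, add_mul, smul_add]
      have hfirst : ((-q) ^ ((r + 1) * (m + 1 - 0))) •
            (fgen k q t (r + 1) * fgen k q (m + 1) 0) =
          ((-q) ^ (r + 1)) • (((-q) ^ ((r + 1) * (m - 0))) •
            (fgen k q t (r + 1) * fgen k q m 0) * Xa k) := by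
        simp only [fgen_zero_right, smul_mul_assoc, smul_smul, ← pow_add, mul_assoc, ← pow_succ,
          Nat.sub_zero]
        congr 2
        ring
      rw [hfirst]
      abel

/-- STATEMENT 9: the comultiplicative identity
`f^n_r = Σ_{j = max(0, r+t−n)}^{min(t, r)} (−q)^{j(n−r+j−t)} f^t_j · f^{n−t}_{r−j}`
for all `0 ≤ t ≤ n` and `0 ≤ r ≤ n`. -/
theorem stmt9 (n t r : ℕ) (ht : t ≤ n) (hr : r ≤ n) :
    fgen k q n r =
      ∑ j ∈ Finset.Icc (r + t - n) (min t r),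
        ((-q) ^ (j * (n + j - r - t))) • (fgen k q t j * fgen k q (n - t) (r - j)) := by
  obtain ⟨m, rfl⟩ := Nat.exists_eq_add_of_le ht
  rw [fgen_add, Finset.Nat.sum_antidiagonal_eq_sum_range_succ
    (fun j l => ((-q) ^ (j * (m - l))) • (fgen k q t j * fgen k q m l)), Nat.add_sub_cancel_left]
  symm
  refine Finset.sum_subset_zero_on_sdiff (fun j hj => ?_) (fun j hj => ?_) (fun j hj => ?_)
  · simp only [Finset.mem_Icc, Finset.mem_range] at hj ⊢
    omega
  · simp only [Finset.mem_sdiff, Finset.mem_Icc, Finset.mem_range] at hj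
    rcases lt_or_ge t j with h | h
    · simp [fgen_eq_zero_of_lt k q h]
    · simp [fgen_eq_zero_of_lt k q (show m < r - j by omega)]
  · rw [Finset.mem_Icc] at hj
    rw [show t + m + j - r - t = m - (r - j) by omega]

end
end

section
/- The unital k-subalgebra k·1 + T of k[x,y], where T is the span of all monomials x^{2i}y^{2j} with i ≥ 0 and j ≥ 1, is not finitely generated as a k-algebra. -/
noncomputable section

variable (k : Type) [Field k]

/-- The set of monomials `x^{2i} y^{2j}` with `i ≥ 0`, `j ≥ 1`, inside `k[x,y]`
(with `x = X 0` and `y = X 1`).  Its `k`-span is `T = k[x²,y²]y²`. -/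
def Tmon : Set (MvPolynomial (Fin 2) k) :=
  {p | ∃ i j : ℕ, 1 ≤ j ∧ p = MvPolynomial.X 0 ^ (2 * i) * MvPolynomial.X 1 ^ (2 * j)}

/-- The subalgebra of polynomials whose monomials all have exponents in a given submonoid. -/
def exponentSubalgebra {σ R : Type*} [CommSemiring R] (S : AddSubmonoid (σ →₀ ℕ)) :
    Subalgebra R (MvPolynomial σ R) where
  carrier := {p | ∀ m ∈ p.support, m ∈ S}
  mul_mem' := by
    classical
    intro p q hp hq m hm
    obtain ⟨a, ha, b, hb, rfl⟩ := Finset.mem_add.1 (MvPolynomial.support_mul p q hm)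
    exact S.add_mem (hp a ha) (hq b hb)
  add_mem' := by
    classical
    intro p q hp hq m hm
    rcases Finset.mem_union.1 (MvPolynomial.support_add hm) with h | h
    · exact hp m h
    · exact hq m h
  algebraMap_mem' := by
    classical
    intro r m hm
    rw [MvPolynomial.algebraMap_eq, MvPolynomial.mem_support_iff, MvPolynomial.coeff_C] at hm
    have h0 : 0 = m := by
      by_contra h
      simp [h] at hm
    exact h0 ▸ S.zero_mem

theorem mem_exponentSubalgebra {σ R : Type*} [CommSemiring R] {S : AddSubmonoid (σ →₀ ℕ)}
    {p : MvPolynomial σ R} : p ∈ exponentSubalgebra S ↔ ∀ m ∈ p.support, m ∈ S :=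
  Iff.rfl

/-- Bivariate exponents that are zero, or have second entry at least two, where the first entry
is at most `N` if the second one is exactly two. -/
def boundedExponents (N : ℕ) : AddSubmonoid (Fin 2 →₀ ℕ) where
  carrier := {m | (m 1 = 0 ∧ m 0 = 0) ∨ (m 1 = 2 ∧ m 0 ≤ N) ∨ 3 ≤ m 1}
  zero_mem' := by simp
  add_mem' := by
    intro a b ha hb
    simp only [Set.mem_ofPred_eq, Finsupp.add_apply] at ha hb ⊢
    omega

theorem mem_boundedExponents {N : ℕ} {m : Fin 2 →₀ ℕ} :
    m ∈ boundedExponents N ↔ (m 1 = 0 ∧ m 0 = 0) ∨ (m 1 = 2 ∧ m 0 ≤ N) ∨ 3 ≤ m 1 :=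
  Iff.rfl

theorem X_pow_mul_X_pow_eq_monomial {R : Type*} [CommSemiring R] (a b : ℕ) :
    (MvPolynomial.X 0 ^ a * MvPolynomial.X 1 ^ b : MvPolynomial (Fin 2) R) =
      MvPolynomial.monomial (Finsupp.single 0 a + Finsupp.single 1 b) 1 := by
  rw [MvPolynomial.X_pow_eq_monomial, MvPolynomial.X_pow_eq_monomial, MvPolynomial.monomial_mul,
    one_mul]

theorem exponents_of_mem_span_Tmon {p : MvPolynomial (Fin 2) k}
    (hp : p ∈ Submodule.span k ({1} ∪ Tmon k)) {m : Fin 2 →₀ ℕ} (hm : m ∈ p.support) :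
    (m 1 = 0 ∧ m 0 = 0) ∨ 2 ≤ m 1 := by
  classical
  induction hp using Submodule.span_induction with
  | mem p h =>
    rcases h with rfl | ⟨i, j, hj, rfl⟩
    · rw [MvPolynomial.support_one, Finset.mem_singleton] at hm
      simp [hm]
    · rw [X_pow_mul_X_pow_eq_monomial] at hm
      have h := Finset.mem_singleton.1 (MvPolynomial.support_monomial_subset hm)
      right
      simp [h]
      omega
  | zero => simp at hm
  | add p q _ _ hp hq =>
    rcases Finset.mem_union.1 (MvPolynomial.support_add hm) with h | h
    · exact hp h
    · exact hq h
  | smul c p _ hp => exact hp (MvPolynomial.support_smul hm)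

/-- STATEMENT 18: the unital `k`-subalgebra `k·1 + T` of `k[x,y]`, where `T` is the
span of the monomials `x^{2i}y^{2j}` with `i ≥ 0`, `j ≥ 1`, is not finitely
generated as a `k`-algebra. -/
theorem stmt18 :
    ¬ ∃ s : Finset (MvPolynomial (Fin 2) k),
      Subalgebra.toSubmodule (Algebra.adjoin k (s : Set (MvPolynomial (Fin 2) k))) =
        Submodule.span k ({1} ∪ Tmon k) := by
  rintro ⟨s, hs⟩
  set N := s.sup (MvPolynomial.degreeOf 0)
  have hle : Algebra.adjoin k (s : Set (MvPolynomial (Fin 2) k)) ≤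
      exponentSubalgebra (boundedExponents N) := by
    refine Algebra.adjoin_le fun p hp => mem_exponentSubalgebra.2 fun m hm => ?_
    have hspan : p ∈ Submodule.span k ({1} ∪ Tmon k) := by
      rw [← hs]
      exact Algebra.subset_adjoin hp
    have hexp := exponents_of_mem_span_Tmon k hspan hm
    have hdeg : m 0 ≤ N :=
      (MvPolynomial.monomial_le_degreeOf 0 hm).trans
        (Finset.le_sup (f := MvPolynomial.degreeOf 0) hp)
    rw [mem_boundedExponents]
    omega
  have hmem : (MvPolynomial.X 0 ^ (2 * (N + 1)) * MvPolynomial.X 1 ^ (2 * 1) :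
      MvPolynomial (Fin 2) k) ∈ Algebra.adjoin k (s : Set (MvPolynomial (Fin 2) k)) := by
    rw [← Subalgebra.mem_toSubmodule, hs]
    exact Submodule.subset_span (Or.inr ⟨N + 1, 1, le_rfl, rfl⟩)
  rw [X_pow_mul_X_pow_eq_monomial] at hmem
  have h := mem_exponentSubalgebra.1 (hle hmem)
    (Finsupp.single 0 (2 * (N + 1)) + Finsupp.single 1 (2 * 1)) (by simp)
  rw [mem_boundedExponents] at h
  simp at h
  omega

end
end
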